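/- Let A be a finite-dimensional regular weak Hopf algebra over an algebraically closed field k of characteristic 0, let ℓ ∈ A be a non-degenerate left integral, and let λ ∈ A* be the dual left integral (the unique left integral in A* with λ⇀ℓ = 1). Then for every k-linear endomorphism T of A one has Tr(T) = ⟨λ, T(S⁻¹(ℓ₁))·ℓ₂⟩, where Δ(ℓ) = ℓ₁⊗ℓ₂. -/

import Mathlib

open TensorProduct

noncomputable section

variable (k : Type*) [Field k] (A : Type*) [Ring A] [Algebra k A]

/-- A weak Hopf algebra structure on the `k`-algebra `A` (Böhm–Szlachányi). -/
structure WeakHopf : Type _ where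
  comul : A →ₗ[k] A ⊗[k] A
  counit : A →ₗ[k] k
  antipode : A →ₗ[k] A
  antipode_bijective : Function.Bijective antipode
  comul_coassoc :
      (TensorProduct.map comul LinearMap.id).comp comul
        = (TensorProduct.assoc k A A A).symm.toLinearMap.comp
            ((TensorProduct.map LinearMap.id comul).comp comul)
  counit_comul_left : ∀ a : A,
      TensorProduct.lid k A (TensorProduct.map counit LinearMap.id (comul a)) = a
  counit_comul_right : ∀ a : A,
      TensorProduct.rid k A (TensorProduct.map LinearMap.id counit (comul a)) = a
  comul_mul : ∀ g h : A, comul (g * h) = comul g * comul h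
  comul_one_left :
      TensorProduct.map comul LinearMap.id (comul 1)
        = (comul 1 ⊗ₜ[k] (1 : A))
            * (TensorProduct.assoc k A A A).symm ((1 : A) ⊗ₜ[k] comul 1)
  comul_one_right :
      TensorProduct.map comul LinearMap.id (comul 1)
        = (TensorProduct.assoc k A A A).symm ((1 : A) ⊗ₜ[k] comul 1)
            * (comul 1 ⊗ₜ[k] (1 : A))
  counit_mul_left : ∀ f g h : A,
      counit (f * g * h)
        = TensorProduct.lift ((LinearMap.mul k k).compl₁₂
            (counit ∘ₗ LinearMap.mulLeft k f) (counit ∘ₗ LinearMap.mulRight k h)) (comul g)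
  counit_mul_right : ∀ f g h : A,
      counit (f * g * h)
        = TensorProduct.lift ((LinearMap.mul k k).compl₁₂
            (counit ∘ₗ LinearMap.mulRight k h) (counit ∘ₗ LinearMap.mulLeft k f)) (comul g)
  antipode_left : ∀ h : A,
      LinearMap.mul' k A (TensorProduct.map LinearMap.id antipode (comul h))
        = TensorProduct.lid k A
            (TensorProduct.map counit LinearMap.id (comul 1 * (h ⊗ₜ[k] (1 : A))))
  antipode_right : ∀ h : A,
      LinearMap.mul' k A (TensorProduct.map antipode LinearMap.id (comul h))
        = TensorProduct.rid k A
            (TensorProduct.map LinearMap.id counit (((1 : A) ⊗ₜ[k] h) * comul 1))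
  antipode_mid : ∀ h : A,
      LinearMap.mul' k A (TensorProduct.map (LinearMap.mul' k A) LinearMap.id
        (TensorProduct.map (TensorProduct.map antipode LinearMap.id) antipode
          (TensorProduct.map comul LinearMap.id (comul h))))
        = antipode h

namespace WeakHopf

variable {k A}
variable (W : WeakHopf k A)

/-- The target counital map `ε_t(h) = ε(1₍₁₎h)1₍₂₎ = (ε ⊗ id)(Δ(1)(h ⊗ 1))`. -/
def εt : A →ₗ[k] A :=
  (TensorProduct.lid k A).toLinearMap
    ∘ₗ TensorProduct.map W.counit LinearMap.id
    ∘ₗ LinearMap.mulLeft k (W.comul 1)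
    ∘ₗ (TensorProduct.mk k A A).flip 1

/-- The source counital map `ε_s(h) = 1₍₁₎ε(h1₍₂₎) = (id ⊗ ε)((1 ⊗ h)Δ(1))`. -/
def εs : A →ₗ[k] A :=
  (TensorProduct.rid k A).toLinearMap
    ∘ₗ TensorProduct.map LinearMap.id W.counit
    ∘ₗ LinearMap.mulRight k (W.comul 1)
    ∘ₗ TensorProduct.mk k A A 1

/-- The target base `A_t = ε_t(A)`. -/
def targetBase : Submodule k A := LinearMap.range W.εt

/-- The source base `A_s = ε_s(A)`. -/
def sourceBase : Submodule k A := LinearMap.range W.εs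

/-- The minimal weak Hopf subalgebra, generated by `A_s` and `A_t`. -/
def minimalSub : Subalgebra k A :=
  Algebra.adjoin k ((W.targetBase : Set A) ∪ (W.sourceBase : Set A))

/-- `A` is regular if `S²` is the identity on `A_min`. -/
def Regular : Prop := ∀ x ∈ W.minimalSub, W.antipode (W.antipode x) = x

/-- `A` is connected if `Z(A) ∩ A_t = k·1`. -/
def Connected : Prop :=
  ∀ a : A, (a ∈ Subalgebra.center k A ∧ a ∈ W.targetBase) ↔ ∃ c : k, a = c • (1 : A)

/-- `A` is coconnected if `A_s ∩ A_t = k·1`. -/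
def Coconnected : Prop :=
  ∀ a : A, (a ∈ W.sourceBase ∧ a ∈ W.targetBase) ↔ ∃ c : k, a = c • (1 : A)

def Biconnected : Prop := W.Connected ∧ W.Coconnected

/-- A left integral: `hℓ = ε_t(h)ℓ` for all `h`. -/
def IsLeftIntegral (ℓ : A) : Prop := ∀ h : A, h * ℓ = W.εt h * ℓ

/-- A right integral: `rh = rε_s(h)` for all `h`. -/
def IsRightIntegral (r : A) : Prop := ∀ h : A, r * h = r * W.εs h

/-- The Sweedler arrow `φ ⇀ a = a₍₁₎⟨φ, a₍₂₎⟩`. -/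
def harpoon (φ : Module.Dual k A) : A →ₗ[k] A :=
  (TensorProduct.rid k A).toLinearMap
    ∘ₗ TensorProduct.map LinearMap.id φ
    ∘ₗ W.comul

/-- An integral `ℓ` is non-degenerate if `φ ↦ φ ⇀ ℓ` is injective. -/
def IsNondegenerateIntegral (ℓ : A) : Prop :=
  Function.Injective fun φ : Module.Dual k A => W.harpoon φ ℓ

/-- The convolution product on the dual: `(φψ)(h) = φ(h₍₁₎)ψ(h₍₂₎)`. -/
def conv (φ ψ : Module.Dual k A) : Module.Dual k A :=
  TensorProduct.lift ((LinearMap.mul k k).compl₁₂ φ ψ) ∘ₗ W.comul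

/-- The canonical left integral `λ ∈ A*`, `λ(h) = Tr(L_h ∘ S²)`. -/
def canonicalLambda : Module.Dual k A :=
  (LinearMap.trace k A)
    ∘ₗ (LinearMap.llcomp k A A A).flip (W.antipode ∘ₗ W.antipode)
    ∘ₗ (LinearMap.mul k A)

/-- The target counital map of the dual weak Hopf algebra: `ε̂_t(φ) = φ ∘ ε_t`. -/
def dualCounitalTarget (φ : Module.Dual k A) : Module.Dual k A := φ ∘ₗ W.εt

/-- The source counital map of the dual weak Hopf algebra: `ε̂_s(φ) = φ ∘ ε_s`. -/
def dualCounitalSource (φ : Module.Dual k A) : Module.Dual k A := φ ∘ₗ W.εs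

/-- The map `a ↦ e(a₍₁₎)a₍₂₎`; left convolution by `e` on `A*` is precomposition
with this map. -/
def coactL (e : Module.Dual k A) : A →ₗ[k] A :=
  (TensorProduct.lid k A).toLinearMap ∘ₗ TensorProduct.map e LinearMap.id ∘ₗ W.comul

/-- A group-like element: invertible with `Δ(g) = (g⊗g)Δ(1) = Δ(1)(g⊗g)`. -/
def IsGroupLike (g : A) : Prop :=
  IsUnit g ∧ W.comul g = (g ⊗ₜ[k] g) * W.comul 1 ∧ W.comul g = W.comul 1 * (g ⊗ₜ[k] g)

/-- A pivotal element: a group-like `G` with `S²(h) = GhG⁻¹`, i.e. `S²(h)G = Gh`. -/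
def IsPivotal (g : A) : Prop :=
  W.IsGroupLike g ∧ ∀ h : A, W.antipode (W.antipode h) * g = g * h

/-- A trivial group-like element: `g = yS(y)⁻¹` for invertible `y ∈ A_s`
(note `S(y)⁻¹ = S(y⁻¹)`). -/
def IsTrivialGroupLike (g : A) : Prop :=
  ∃ y yi : A, y ∈ W.sourceBase ∧ y * yi = 1 ∧ yi * y = 1 ∧ g = y * W.antipode yi

/-- The character of the trivial `A`-module `A_t`, `h · z = ε_t(hz)`. -/
def trivialChar : A → k := fun h =>
  LinearMap.trace k W.targetBase
    ((W.εt ∘ₗ LinearMap.mulLeft k h).restrict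
      (p := W.targetBase) (q := W.targetBase) (fun x _ => ⟨h * x, rfl⟩))

end WeakHopf

/-- The Wedderburn data of a finite-dimensional semisimple algebra: a complete family
of primitive central idempotents `z j`, together with the matrix sizes `d j`
(so that `(d j)² = dim_k (z j · A)`, i.e. the block `z j · A ≅ M_{d j}(k)`). -/
structure WedderburnData (n : ℕ) : Type _ where
  z : Fin n → A
  d : Fin n → ℕ
  central : ∀ j, z j ∈ Subalgebra.center k A
  idem : ∀ j, z j * z j = z j
  nonzero : ∀ j, z j ≠ 0
  primitive : ∀ (j : Fin n) (q r : A), q ∈ Subalgebra.center k A →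
      r ∈ Subalgebra.center k A → q * q = q → r * r = r → q * r = 0 →
      q + r = z j → q = 0 ∨ r = 0
  orthogonal : ∀ i j, i ≠ j → z i * z j = 0
  total : ∑ j, z j = 1
  d_sq : ∀ j, (d j) ^ 2 = Module.finrank k (LinearMap.range (LinearMap.mulLeft k (z j)))

/-- The irreducible characters of a finite-dimensional semisimple algebra: the character
of the simple module corresponding to the block `z j · A` is
`χ_j(h) = Tr(L_{z_j h} | A) / d j`. -/
def WedderburnData.char {k A : Type*} [Field k] [Ring A] [Algebra k A] {n : ℕ}
    (D : WedderburnData k A n) : Fin n → Module.Dual k A := fun j =>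
  (D.d j : k)⁻¹ •
    ((LinearMap.trace k A) ∘ₗ (LinearMap.mul k A) ∘ₗ LinearMap.mulLeft k (D.z j))

/-- Frobenius–Perron data for a semisimple weak Hopf algebra over `ℂ`: the non-negative
integer structure constants of the products of the irreducible characters under
convolution, and the Frobenius–Perron dimensions `f j = FPdim(V_j)` of the simple
modules, i.e. the unique strictly positive solution of `f i · f j = Σ_m N i j m · f m`. -/
structure FPData {A : Type*} [Ring A] [Algebra ℂ A] (W : WeakHopf ℂ A) {n : ℕ}
    (D : WedderburnData ℂ A n) : Type _ where
  N : Fin n → Fin n → Fin n → ℕ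
  conv_char : ∀ i j, W.conv (D.char i) (D.char j) = ∑ m, (N i j m : ℂ) • D.char m
  f : Fin n → ℝ
  f_pos : ∀ j, 0 < f j
  f_mul : ∀ i j, f i * f j = ∑ m, (N i j m : ℝ) * f m

/-- A Frobenius–Perron element of `A_s`: a non-zero `w ∈ Z(A_s)` with strictly positive
eigenvalues such that `χ_{V_j} ⇀ w = FPdim(V_j) • w` for all simple modules `V_j`
(hence for all finite-dimensional modules). -/
def WeakHopf.IsFPElement {A : Type*} [Ring A] [Algebra ℂ A] (W : WeakHopf ℂ A) {n : ℕ}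
    (D : WedderburnData ℂ A n) (F : FPData W D) (w : A) : Prop :=
  w ≠ 0 ∧ w ∈ W.sourceBase ∧ (∀ y ∈ W.sourceBase, w * y = y * w) ∧
  (∀ c ∈ spectrum ℂ w, ∃ r : ℝ, 0 < r ∧ c = (r : ℂ)) ∧
  ∀ j, W.harpoon (D.char j) w = ((F.f j : ℂ)) • w

/-- A duality pairing realizing the weak Hopf algebra `B` as the dual `A*` of the weak
Hopf algebra `A` (so that `B` carries the dual weak Hopf algebra structure:
`⟨φψ, h⟩ = ⟨φ, h₍₁₎⟩⟨ψ, h₍₂₎⟩`, `1_B = ε_A`, `⟨Δφ, g ⊗ h⟩ = ⟨φ, gh⟩`,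
`ε_B(φ) = ⟨φ, 1⟩`, `⟨S_B(φ), h⟩ = ⟨φ, S_A(h)⟩`). -/
structure DualPair {k A B : Type*} [Field k] [Ring A] [Algebra k A] [Ring B] [Algebra k B]
    (W : WeakHopf k A) (W' : WeakHopf k B) : Type _ where
  pair : B →ₗ[k] Module.Dual k A
  bij : Function.Bijective pair
  mul_compat : ∀ φ ψ : B, pair (φ * ψ) = W.conv (pair φ) (pair ψ)
  one_compat : pair 1 = W.counit
  comul_compat : ∀ (φ : B) (g h : A),
      TensorProduct.lift ((LinearMap.mul k k).compl₁₂ (pair.flip g) (pair.flip h))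
          (W'.comul φ) = pair φ (g * h)
  counit_compat : ∀ φ : B, W'.counit φ = pair φ 1
  antipode_compat : ∀ (φ : B) (h : A), pair (W'.antipode φ) h = pair φ (W.antipode h)

namespace WeakHopf

variable {k A : Type*} [Field k] [Ring A] [Algebra k A] (W : WeakHopf k A)

theorem aux_coassoc (y : A) : TensorProduct.map W.comul LinearMap.id (W.comul y)
    = (TensorProduct.assoc k A A A).symm (TensorProduct.map LinearMap.id W.comul (W.comul y)) :=
  LinearMap.congr_fun W.comul_coassoc y

theorem aux_one_mul (y : A) : W.comul 1 * W.comul y = W.comul y := by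
  rw [← W.comul_mul, one_mul]

theorem aux_mul_one (y : A) : W.comul y * W.comul 1 = W.comul y := by
  rw [← W.comul_mul, mul_one]

theorem aux_εt_apply (h : A) : W.εt h = TensorProduct.lid k A
    (TensorProduct.map W.counit LinearMap.id (W.comul 1 * (h ⊗ₜ[k] (1 : A)))) := rfl

theorem aux_εs_apply (h : A) : W.εs h = TensorProduct.rid k A
    (TensorProduct.map LinearMap.id W.counit (((1 : A) ⊗ₜ[k] h) * W.comul 1)) := rfl

/-- `(u ⊗ v) ⊗ w ↦ ε(u h) v ⊗ w` -/
def auxG (h : A) : (A ⊗[k] A) ⊗[k] A →ₗ[k] A ⊗[k] A :=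
  TensorProduct.map ((TensorProduct.lid k A).toLinearMap ∘ₗ
    TensorProduct.map (W.counit ∘ₗ LinearMap.mulRight k h) LinearMap.id) LinearMap.id

theorem aux_comul_εt (h : A) : W.comul (W.εt h) = (W.εt h ⊗ₜ[k] (1 : A)) * W.comul 1 := by
  have h1 : ∀ t : A ⊗[k] A, W.comul (TensorProduct.lid k A
      (TensorProduct.map W.counit LinearMap.id (t * (h ⊗ₜ[k] (1 : A)))))
      = W.auxG h ((TensorProduct.assoc k A A A).symm
          (TensorProduct.map LinearMap.id W.comul t)) := by
    intro t
    induction t with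
    | zero => simp
    | add x y hx hy => simp only [add_mul, map_add, hx, hy]
    | tmul u v =>
      have : ∀ s : A ⊗[k] A, W.counit (u * h) • s
          = W.auxG h ((TensorProduct.assoc k A A A).symm (u ⊗ₜ[k] s)) := by
        intro s
        induction s with
        | zero => simp
        | add x y hx hy => simp only [tmul_add, smul_add, map_add, hx, hy]
        | tmul p q => simp [auxG, TensorProduct.smul_tmul']
      simp [← this]
  have h2 : ∀ t s : A ⊗[k] A, W.auxG h ((t ⊗ₜ[k] (1 : A))
        * (TensorProduct.assoc k A A A).symm ((1 : A) ⊗ₜ[k] s))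
      = (TensorProduct.lid k A (TensorProduct.map W.counit LinearMap.id
          (t * (h ⊗ₜ[k] (1 : A)))) ⊗ₜ[k] (1 : A)) * s := by
    intro t s
    induction t with
    | zero => simp
    | add x y hx hy => simp only [add_tmul, add_mul, map_add, hx, hy]
    | tmul u v =>
      induction s with
      | zero => simp
      | add x y hx hy => simp only [tmul_add, mul_add, map_add, hx, hy]
      | tmul p q => simp [auxG]
  rw [aux_εt_apply, h1, ← aux_coassoc, W.comul_one_left, h2]

/-- `v ⊗ w ↦ (ε ⊗ id)(D (v ⊗ w))` -/
def auxH (D : A ⊗[k] A) : A ⊗[k] A →ₗ[k] A :=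
  (TensorProduct.lid k A).toLinearMap ∘ₗ
    TensorProduct.map W.counit LinearMap.id ∘ₗ LinearMap.mulLeft k D

theorem aux_εs_comul (y : A) : TensorProduct.map W.εs LinearMap.id (W.comul y)
    = ((1 : A) ⊗ₜ[k] y) * W.comul 1 := by
  have h1 : ∀ t : A ⊗[k] A, TensorProduct.map LinearMap.id (W.auxH (W.comul y))
      (TensorProduct.map LinearMap.id W.comul t) = ((1 : A) ⊗ₜ[k] y) * t := by
    intro t
    induction t with
    | zero => simp
    | add x y hx hy => simp only [mul_add, map_add, hx, hy]
    | tmul u v => simp [auxH, ← W.comul_mul, W.counit_comul_left]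
  have h2 : ∀ D t s : A ⊗[k] A, TensorProduct.map LinearMap.id (W.auxH D)
      (TensorProduct.assoc k A A A ((TensorProduct.assoc k A A A).symm ((1 : A) ⊗ₜ[k] s)
        * (t ⊗ₜ[k] (1 : A))))
      = TensorProduct.map LinearMap.id (W.auxH (D * s))
        (TensorProduct.map LinearMap.id ((TensorProduct.mk k A A).flip 1) t) := by
    intro D t s
    induction t with
    | zero => simp
    | add x y hx hy => simp only [add_tmul, mul_add, map_add, hx, hy]
    | tmul u v =>
      induction s with
      | zero => simp [auxH]
      | add x y hx hy =>
        simp only [tmul_add, add_mul, map_add, hx, hy]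
        simp [auxH, mul_add, add_mul, tmul_add, mul_assoc]
      | tmul p q => simp [auxH, mul_assoc]
  have h3 : ∀ D t : A ⊗[k] A, TensorProduct.map LinearMap.id (W.auxH D)
        (TensorProduct.map LinearMap.id ((TensorProduct.mk k A A).flip 1) t)
      = TensorProduct.map ((TensorProduct.rid k A).toLinearMap
    ∘ₗ TensorProduct.map LinearMap.id W.counit
    ∘ₗ LinearMap.mulRight k t
    ∘ₗ TensorProduct.mk k A A 1) LinearMap.id D := by
    intro D t
    induction D with
    | zero => simp [auxH]
    | add x y hx hy =>
      have hadd : W.auxH (x + y) = W.auxH x + W.auxH y := by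
        ext; simp [auxH, add_mul]
      rw [map_add, ← hx, ← hy, hadd, TensorProduct.map_add_right, LinearMap.add_apply]
    | tmul a b =>
      induction t with
      | zero => simp
      | add x y hx hy =>
        simp only [map_add, hx, hy]
        simp [mul_add, add_tmul]
      | tmul u v => simp [auxH, TensorProduct.smul_tmul']
  have h4 := h1 (W.comul 1)
  rw [← (TensorProduct.assoc k A A A).apply_symm_apply
    (TensorProduct.map LinearMap.id W.comul (W.comul 1)), ← aux_coassoc, W.comul_one_right,
    h2, aux_mul_one, h3] at h4
  exact h4

theorem aux_S_εt (y : A) : LinearMap.mul' k A (TensorProduct.map W.antipode W.εt (W.comul y))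
    = W.antipode y := by
  rw [← W.antipode_mid y, aux_coassoc]
  generalize W.comul y = t
  induction t with
  | zero => simp
  | add x y hx hy => simp only [map_add, hx, hy]
  | tmul u v =>
    have : ∀ s : A ⊗[k] A, W.antipode u *
        LinearMap.mul' k A (TensorProduct.map LinearMap.id W.antipode s) =
        LinearMap.mul' k A (TensorProduct.map (LinearMap.mul' k A) LinearMap.id
        (TensorProduct.map (TensorProduct.map W.antipode LinearMap.id) W.antipode
          ((TensorProduct.assoc k A A A).symm (u ⊗ₜ[k] s)))) := by
      intro s
      induction s with
      | zero => simp
      | add x y hx hy => simp only [tmul_add, mul_add, map_add, hx, hy]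
      | tmul p q => simp [mul_assoc]
    simp only [TensorProduct.map_tmul, LinearMap.id_coe, id_eq, ← this, W.antipode_left,
      LinearMap.mul'_apply, aux_εt_apply]

theorem aux_integral (ℓ : A) (hint : W.IsLeftIntegral ℓ) (y : A) :
    ((1 : A) ⊗ₜ[k] y) * W.comul ℓ = (W.antipode y ⊗ₜ[k] (1 : A)) * W.comul ℓ := by
  have h1 : ∀ t : A ⊗[k] A,
      (TensorProduct.map (LinearMap.mul' k A ∘ₗ TensorProduct.map W.antipode LinearMap.id)
        LinearMap.id ((TensorProduct.assoc k A A A).symm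
          (TensorProduct.map LinearMap.id W.comul t))) * W.comul ℓ
      = (LinearMap.mul' k A (TensorProduct.map W.antipode W.εt t) ⊗ₜ[k] (1 : A))
        * W.comul ℓ := by
    intro t
    induction t with
    | zero => simp
    | add x y hx hy => simp only [add_tmul, add_mul, map_add, hx, hy]
    | tmul u v =>
      have h2 : ∀ s : A ⊗[k] A,
        (TensorProduct.map (LinearMap.mul' k A ∘ₗ TensorProduct.map W.antipode LinearMap.id)
          LinearMap.id ((TensorProduct.assoc k A A A).symm (u ⊗ₜ[k] s)))
          = (W.antipode u ⊗ₜ[k] (1 : A)) * s := by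
        intro s
        induction s with
        | zero => simp
        | add x y hx hy => simp only [tmul_add, mul_add, map_add, hx, hy]
        | tmul p q => simp
      simp only [TensorProduct.map_tmul, LinearMap.id_coe, id_eq, h2, LinearMap.mul'_apply]
      rw [mul_assoc, ← W.comul_mul, hint v, W.comul_mul, aux_comul_εt, mul_assoc, aux_one_mul,
        ← mul_assoc, Algebra.TensorProduct.tmul_mul_tmul, mul_one]
  have h3 : ∀ t : A ⊗[k] A,
      TensorProduct.map (LinearMap.mul' k A ∘ₗ TensorProduct.map W.antipode LinearMap.id)
        LinearMap.id (TensorProduct.map W.comul LinearMap.id t)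
      = TensorProduct.map W.εs LinearMap.id t := by
    intro t
    induction t with
    | zero => simp
    | add x y hx hy => simp only [map_add, hx, hy]
    | tmul u v =>
      simp only [TensorProduct.map_tmul, LinearMap.id_coe, id_eq, LinearMap.comp_apply,
        W.antipode_right, aux_εs_apply]
  have h4 := h1 (W.comul y)
  rw [aux_S_εt, ← aux_coassoc, h3, aux_εs_comul, mul_assoc, aux_one_mul] at h4
  exact h4

end WeakHopf

/-- If `ℓ` is a non-degenerate left integral of a finite-dimensional
regular weak Hopf algebra and `λ ∈ A*` is its dual left integral (a left integral of the
dual weak Hopf algebra with `λ ⇀ ℓ = 1`), then for every `k`-linear endomorphism `T` of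
`A`, `Tr(T) = ⟨λ, T(S⁻¹(ℓ₍₁₎))·ℓ₍₂₎⟩`.  (A left integral of `A*` is `λ` with
`φλ = ε̂_t(φ)λ` for all `φ ∈ A*`, where `ε̂_t(φ) = φ ∘ ε_t`.) -/
theorem stmt_12 {k A : Type*} [Field k] [IsAlgClosed k] [CharZero k]
    [Ring A] [Algebra k A] [FiniteDimensional k A]
    (W : WeakHopf k A) (hreg : W.Regular)
    (ℓ : A) (hint : W.IsLeftIntegral ℓ) (hnd : W.IsNondegenerateIntegral ℓ)
    (lam : Module.Dual k A)
    (hlam_int : ∀ φ : Module.Dual k A,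
        W.conv φ lam = W.conv (W.dualCounitalTarget φ) lam)
    (hdual : W.harpoon lam ℓ = 1) :
    ∀ T : A →ₗ[k] A,
      LinearMap.trace k A T
        = TensorProduct.lift
            (((LinearMap.mul k A).compl₁₂
                (T ∘ₗ (LinearEquiv.ofBijective W.antipode W.antipode_bijective).symm.toLinearMap)
                LinearMap.id).compr₂ lam)
            (W.comul ℓ) := by
  set Si := (LinearEquiv.ofBijective W.antipode W.antipode_bijective).symm with hSi
  have key : ∀ y : A, TensorProduct.rid k A (TensorProduct.map Si.toLinearMap
      (lam ∘ₗ LinearMap.mulLeft k y) (W.comul ℓ)) = y := by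
    intro y
    have e1 : ∀ t : A ⊗[k] A, TensorProduct.rid k A (TensorProduct.map Si.toLinearMap
        (lam ∘ₗ LinearMap.mulLeft k y) t)
        = Si (TensorProduct.rid k A (TensorProduct.map LinearMap.id lam
          (((1 : A) ⊗ₜ[k] y) * t))) := by
      intro t
      induction t with
      | zero => simp
      | add x y hx hy => simp only [mul_add, map_add, hx, hy]
      | tmul u v => simp
    have e2 : ∀ t : A ⊗[k] A, TensorProduct.rid k A (TensorProduct.map LinearMap.id lam
          ((W.antipode y ⊗ₜ[k] (1 : A)) * t))
        = W.antipode y * TensorProduct.rid k A (TensorProduct.map LinearMap.id lam t) := by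
      intro t
      induction t with
      | zero => simp
      | add x y hx hy => simp only [mul_add, map_add, hx, hy]
      | tmul u v => simp
    have e3 : TensorProduct.rid k A (TensorProduct.map LinearMap.id lam (W.comul ℓ)) = 1 := hdual
    rw [e1, W.aux_integral ℓ hint, e2, e3, mul_one, hSi]
    exact (LinearEquiv.ofBijective W.antipode W.antipode_bijective).symm_apply_apply y
  intro T
  have hT : ∀ u : Module.Dual k A ⊗[k] A,
      LinearMap.trace k A (dualTensorHom k A A u) = TensorProduct.lift
            (((LinearMap.mul k A).compl₁₂
                (dualTensorHom k A A u ∘ₗ Si.toLinearMap)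
                LinearMap.id).compr₂ lam)
            (W.comul ℓ) := by
    intro u
    induction u with
    | zero => 
      have : ∀ t : A ⊗[k] A, (0 : k) = TensorProduct.lift
            (((LinearMap.mul k A).compl₁₂
                ((0 : A →ₗ[k] A) ∘ₗ Si.toLinearMap)
                LinearMap.id).compr₂ lam) t := by
        intro t
        induction t with
        | zero => simp
        | add x y hx hy => rw [map_add, ← hx, ← hy, add_zero]
        | tmul u v => simp
      rw [map_zero, map_zero]
      exact this _
    | add x y hx hy =>
      rw [map_add, map_add, hx, hy]
      generalize W.comul ℓ = t
      induction t with
      | zero => simp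
      | add a b ha hb => simp only [map_add] at *; rw [← ha, ← hb]; abel
      | tmul u v => simp [add_mul]
    | tmul f y =>
      rw [LinearMap.trace_eq_contract_apply, contractLeft_apply]
      conv_lhs => rw [← key y]
      generalize W.comul ℓ = t
      induction t with
      | zero => simp
      | add a b ha hb => simp only [map_add, ha, hb]
      | tmul u v => simp [mul_comm]
  obtain ⟨u, rfl⟩ := (dualTensorHomEquiv k A A).surjective T
  simpa using hT u
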